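/- A bimould M = (M_d)_{d≥0} with coefficients in a ℚ-algebra R is b-symmetril if and only if the bimould M^{#_Y} is symmetril, where M_d^{#_Y}(X₁,…,X_d;Y₁,…,Y_d) = M_d(X₁,…,X_d; Y₁, Y₁+Y₂, …, Y₁+⋯+Y_d). -/

import Mathlib

/-!
STATEMENT 10: a bimould `M` with coefficients in a `ℚ`-algebra `R` is b-symmetril if
and only if the bimould `M^{#_Y}` (obtained by the substitution
`Y_i ↦ Y₁ + ⋯ + Y_i`) is symmetril.

A bimould with coefficients in `R` is a family `M : ∀ d, ((Fin d ⊕ Fin d) →₀ ℕ) → R`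
of formal power series, given coefficientwise (`Sum.inl i ↔ X_{i+1}`,
`Sum.inr i ↔ Y_{i+1}`).  `ℚ⟨Y^bi⟩` is realized as `List (ℕ × ℕ) →₀ ℚ` (a letter
`(a,m)` standing for `y_{a+1,m}`), `ℚ⟨B⟩` as `List ℕ →₀ ℚ`.

The substitution `Y_i ↦ Y₁+⋯+Y_i`, expanded coefficientwise, reads:
the coefficient of `M^{#_Y}_d` at exponents `(x, y)` is the sum over all matrices
`c = (c_{ij})` with `c_{ij} = 0` for `j > i` and column sums `∑_i c_{ij} = y_j`, of
`∏_i multinomial(c_{i1},…,c_{id})` times the coefficient of `M_d` at `(x, (∑_j c_{ij})_i)`.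
-/

open Finsupp

/-- `ℚ⟨Y^bi⟩`; a letter `(a, m)` stands for `y_{a+1,m}`. -/
abbrev QY : Type := List (ℕ × ℕ) →₀ ℚ

/-- `ℚ⟨B⟩`. -/
abbrev QB : Type := List ℕ →₀ ℚ

/-- The word `y_{k₁,m₁} ⋯ y_{k_d,m_d}` of `ℚ⟨Y^bi⟩`. -/
noncomputable def wY (w : List (ℕ × ℕ)) : QY := Finsupp.single w 1

/-- The word `b_{s₁} ⋯ b_{s_l}` of `ℚ⟨B⟩`. -/
noncomputable def wB (w : List ℕ) : QB := Finsupp.single w 1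

/-- Left concatenation by a letter, extended `ℚ`-linearly. -/
noncomputable def consY (a : ℕ × ℕ) (x : QY) : QY := Finsupp.mapDomain (List.cons a) x

/-- Left concatenation by the letter `b_a`, extended `ℚ`-linearly. -/
noncomputable def consB (a : ℕ) (x : QB) : QB := Finsupp.mapDomain (List.cons a) x

/-- The stuffle product `∗` on words of `ℚ⟨Y^bi⟩`. -/
noncomputable def stufW : List (ℕ × ℕ) → List (ℕ × ℕ) → QY
  | [], w => wY w
  | x :: u, [] => wY (x :: u)
  | x :: u, y :: v =>
      consY x (stufW u (y :: v)) + consY y (stufW (x :: u) v) +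
        consY (x.1 + y.1 + 1, x.2 + y.2) (stufW u v)
  termination_by u v => u.length + v.length

/-- The stuffle product `∗` on `ℚ⟨Y^bi⟩` (ℚ-bilinear extension). -/
noncomputable def stuf (x y : QY) : QY :=
  x.sum fun u a => y.sum fun v b => (a * b) • stufW u v

/-- The balanced quasi-shuffle product `∗_b` on words of `ℚ⟨B⟩`. -/
noncomputable def bshW : List ℕ → List ℕ → QB
  | [], w => wB w
  | i :: u, [] => wB (i :: u)
  | i :: u, j :: v =>
      consB i (bshW u (j :: v)) + consB j (bshW (i :: u) v) +
        (if 1 ≤ i ∧ 1 ≤ j then consB (i + j) (bshW u v) else 0)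
  termination_by u v => u.length + v.length

/-- The balanced quasi-shuffle product `∗_b` on `ℚ⟨B⟩` (ℚ-bilinear extension). -/
noncomputable def bsh (x y : QB) : QB :=
  x.sum fun u a => y.sum fun v b => (a * b) • bshW u v

/-- `ℚ⟨B⟩⁰`: the subspace of `ℚ⟨B⟩` spanned by `𝟏` and the words not starting in `b₀`. -/
noncomputable def QB0 : Submodule ℚ QB :=
  Submodule.span ℚ {x | ∃ w : List ℕ, w.head? ≠ some 0 ∧ x = wB w}

/-- A bimould `M` with coefficients in `R` is *symmetril* if there is an algebra
morphism `φ : (ℚ⟨Y^bi⟩, ∗) → R` with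
`M_d = ∑ φ(y_{k₁,m₁}⋯y_{k_d,m_d}) X₁^{k₁-1}(Y₁^{m₁}/m₁!)⋯X_d^{k_d-1}(Y_d^{m_d}/m_d!)`
for all `d` (the case `d = 0` giving `M₀ = 1`). -/
def Symmetril {R : Type*} [Ring R] [Algebra ℚ R]
    (M : ∀ d : ℕ, ((Fin d ⊕ Fin d) →₀ ℕ) → R) : Prop :=
  ∃ φ : QY →ₗ[ℚ] R, φ (wY []) = 1 ∧ (∀ x y : QY, φ (stuf x y) = φ x * φ y) ∧
    ∀ (d : ℕ) (e : (Fin d ⊕ Fin d) →₀ ℕ),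
      M d e = (∏ i : Fin d, ((e (Sum.inr i)).factorial : ℚ))⁻¹ •
        φ (wY (List.ofFn fun i : Fin d => (e (Sum.inl i), e (Sum.inr i))))

/-- A bimould `M` with coefficients in `R` is *b-symmetril* if there is an algebra
morphism `ψ : (ℚ⟨B⟩⁰, ∗_b) → R` with
`M_d = ∑ ψ(b_{k₁}b₀^{m₁}⋯b_{k_d}b₀^{m_d}) X₁^{k₁-1}Y₁^{m₁}⋯X_d^{k_d-1}Y_d^{m_d}`
for all `d` (the case `d = 0` giving `M₀ = 1`). -/
def BSymmetril {R : Type*} [Ring R] [Algebra ℚ R]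
    (M : ∀ d : ℕ, ((Fin d ⊕ Fin d) →₀ ℕ) → R) : Prop :=
  ∃ ψ : QB →ₗ[ℚ] R, ψ (wB []) = 1 ∧
    (∀ x y : QB, x ∈ QB0 → y ∈ QB0 → ψ (bsh x y) = ψ x * ψ y) ∧
    ∀ (d : ℕ) (e : (Fin d ⊕ Fin d) →₀ ℕ),
      M d e = ψ (wB ((List.ofFn fun i : Fin d =>
        (e (Sum.inl i) + 1) :: List.replicate (e (Sum.inr i)) 0).flatten))

/-- The set of matrices `c` (given by their columns `c j : Fin d → ℕ`) with column sums
`∑_i c j i = m j` and vanishing strictly above the diagonal. -/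
noncomputable def matSet (d : ℕ) (m : Fin d → ℕ) : Finset (Fin d → Fin d → ℕ) :=
  (Fintype.piFinset fun j : Fin d => Finset.Nat.antidiagonalTuple d (m j)).filter
    fun c => ∀ i j : Fin d, i < j → c j i = 0

/-- The operation `M ↦ M^{#_Y}`: the substitution `Y_i ↦ Y₁ + ⋯ + Y_i`,
coefficientwise. -/
noncomputable def sharpY {R : Type*} [Ring R] [Algebra ℚ R]
    (M : ∀ d : ℕ, ((Fin d ⊕ Fin d) →₀ ℕ) → R) :
    ∀ d : ℕ, ((Fin d ⊕ Fin d) →₀ ℕ) → R := fun d e =>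
  ∑ c ∈ matSet d fun j => e (Sum.inr j),
    (∏ i : Fin d, (Nat.multinomial Finset.univ (fun j => c j i) : ℚ)) •
      M d (Finsupp.equivFunOnFinite.symm
        (Sum.elim (fun i => e (Sum.inl i)) fun i => ∑ j : Fin d, c j i))

/-! ### Linear versions of the operations -/

noncomputable def cB (a : ℕ) : QB →ₗ[ℚ] QB := Finsupp.lmapDomain ℚ ℚ (List.cons a)

theorem consB_eq (a : ℕ) (x : QB) : consB a x = cB a x := rfl

theorem cB_wB (a : ℕ) (w : List ℕ) : cB a (wB w) = wB (a :: w) := by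
  simp [cB, wB, Finsupp.lmapDomain_apply, Finsupp.mapDomain_single]

/-- Induction principle: linear statements are checked on words. -/
theorem hom_ext_B {N : Type*} [AddCommMonoid N] [Module ℚ N] {f g : QB →ₗ[ℚ] N}
    (h : ∀ w, f (wB w) = g (wB w)) : f = g := by
  apply Finsupp.lhom_ext
  intro w b
  have : (Finsupp.single w b : QB) = b • wB w := by simp [wB]
  rw [this, map_smul, map_smul, h]

theorem hom_ext_Y {N : Type*} [AddCommMonoid N] [Module ℚ N] {f g : QY →ₗ[ℚ] N}
    (h : ∀ w, f (wY w) = g (wY w)) : f = g := by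
  apply Finsupp.lhom_ext
  intro w b
  have : (Finsupp.single w b : QY) = b • wY w := by simp [wY]
  rw [this, map_smul, map_smul, h]

noncomputable def BB : QB →ₗ[ℚ] QB →ₗ[ℚ] QB :=
  Finsupp.linearCombination ℚ fun u => Finsupp.linearCombination ℚ (bshW u)

theorem bsh_eq (x y : QB) : bsh x y = BB x y := by
  simp only [bsh, BB, Finsupp.linearCombination_apply, Finsupp.sum, LinearMap.sum_apply,
    LinearMap.smul_apply, Finset.smul_sum, mul_smul]

theorem BB_wB (u v : List ℕ) : BB (wB u) (wB v) = bshW u v := by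
  simp [BB, wB]

theorem BB_one_left (x : QB) : BB (wB []) x = x := by
  have : BB (wB []) = LinearMap.id := hom_ext_B fun w => by
    rw [BB_wB]; simp [bshW]
  rw [this]; rfl

theorem BB_one_right (x : QB) : BB x (wB []) = x := by
  have : BB.flip (wB []) = LinearMap.id := hom_ext_B fun w => by
    rw [LinearMap.flip_apply, BB_wB]; cases w <;> simp [bshW]
  have h2 := congrArg (fun f => f x) this
  simpa using h2

theorem BB_cons (i j : ℕ) (x y : QB) : BB (cB i x) (cB j y) =
    cB i (BB x (cB j y)) + cB j (BB (cB i x) y) +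
      (if 1 ≤ i ∧ 1 ≤ j then cB (i + j) (BB x y) else 0) := by
  induction x using Finsupp.induction_linear with
  | zero => simp
  | add f g hf hg =>
    simp only [map_add, LinearMap.add_apply, hf, hg]
    split_ifs <;> abel
  | single u a =>
    induction y using Finsupp.induction_linear with
    | zero => simp
    | add f g hf hg =>
      simp only [map_add, hf, hg]
      split_ifs <;> abel
    | single v b =>
      have h1 : (Finsupp.single u a : QB) = a • wB u := by simp [wB]
      have h2 : (Finsupp.single v b : QB) = b • wB v := by simp [wB]
      rw [h1, h2]
      simp only [map_smul, LinearMap.smul_apply, cB_wB, BB_wB]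
      rw [bshW]
      simp only [consB_eq]
      split_ifs <;> simp [smul_add]

theorem BB_comm (x y : QB) : BB x y = BB y x := by
  have : BB = BB.flip := by
    apply hom_ext_B
    intro u
    apply hom_ext_B
    intro v
    rw [LinearMap.flip_apply]
    induction u generalizing v with
    | nil => rw [BB_one_left, BB_one_right]
    | cons i u ihu =>
      induction v with
      | nil => rw [BB_one_left, BB_one_right]
      | cons j v ihv =>
        have h1 := ihu (j :: v)
        have h2 := ihu v
        rw [← cB_wB, ← cB_wB] at *
        rw [BB_cons, BB_cons, h1, h2, ihv, add_comm i j]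
        simp only [and_comm (a := 1 ≤ i)]
        abel
  conv_lhs => rw [this]
  rfl

noncomputable def DW : List ℕ → QB
  | [] => wB [0]
  | a :: w => wB (0 :: a :: w) + cB a (DW w)

/-- Multiplication by `b₀`. -/
noncomputable def DD : QB →ₗ[ℚ] QB := Finsupp.linearCombination ℚ DW

theorem DD_wB (w : List ℕ) : DD (wB w) = DW w := by simp [DD, wB]

theorem DD_nil : DD (wB []) = cB 0 (wB []) := by rw [DD_wB, cB_wB]; rfl

theorem DD_cB (a : ℕ) (x : QB) : DD (cB a x) = cB 0 (cB a x) + cB a (DD x) := by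
  have : DD ∘ₗ cB a = cB 0 ∘ₗ cB a + cB a ∘ₗ DD := hom_ext_B fun w => by
    simp [cB_wB, DD_wB, DW]
  exact congrArg (fun f => f x) this

theorem BB_zero (x : QB) : BB (cB 0 (wB [])) x = DD x := by
  have : BB (cB 0 (wB [])) = DD := hom_ext_B fun w => by
    induction w with
    | nil => rw [BB_one_right, DD_nil]
    | cons a w ih =>
      rw [← cB_wB, BB_cons, BB_one_left, DD_cB, ih]
      simp
  rw [this]

theorem BB_DD_left (x y : QB) : BB (DD x) y = DD (BB x y) := by
  have : BB ∘ₗ DD = BB.compr₂ DD := by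
    apply hom_ext_B
    intro u
    apply hom_ext_B
    intro v
    rw [LinearMap.comp_apply, LinearMap.compr₂_apply]
    induction u generalizing v with
    | nil => rw [BB_one_left, DD_nil, BB_zero]
    | cons i u ihu =>
      induction v with
      | nil => rw [BB_one_right, BB_one_right]
      | cons j v ihv =>
        have h1 := ihu (j :: v)
        have h2 := ihu v
        rw [← cB_wB, ← cB_wB] at *
        rw [DD_cB, map_add, LinearMap.add_apply] at ihv ⊢
        rw [BB_cons 0, BB_cons i j (DD _), BB_cons i j (wB u), h1, h2]
        simp only [map_add, DD_cB]
        rw [← ihv]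
        simp only [map_add]
        rw [if_neg (show ¬ (1 ≤ 0 ∧ 1 ≤ j) by omega)]
        split_ifs
        · rw [DD_cB]; abel
        · simp only [map_zero]; abel
  exact congrArg (fun f => f x y) this

theorem BB_DD_right (x y : QB) : BB x (DD y) = DD (BB x y) := by
  rw [BB_comm, BB_DD_left, BB_comm]

theorem BB_DDpow_left (m : ℕ) (x y : QB) : BB ((DD ^ m) x) y = (DD ^ m) (BB x y) := by
  induction m with
  | zero => simp
  | succ m ih => rw [pow_succ', Module.End.mul_apply, BB_DD_left, ih, Module.End.mul_apply]

theorem BB_DDpow_right (m : ℕ) (x y : QB) : BB x ((DD ^ m) y) = (DD ^ m) (BB x y) := by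
  rw [BB_comm, BB_DDpow_left, BB_comm]

/-! ### The algebra morphism `ℚ⟨Y^bi⟩ → ℚ⟨B⟩⁰` -/

noncomputable def ThW : List (ℕ × ℕ) → QB
  | [] => wB []
  | a :: w => cB (a.1 + 1) ((DD ^ a.2) (ThW w))

noncomputable def Th : QY →ₗ[ℚ] QB := Finsupp.linearCombination ℚ ThW

theorem Th_wY (w : List (ℕ × ℕ)) : Th (wY w) = ThW w := by simp [Th, wY]

theorem Th_consY (a : ℕ × ℕ) (x : QY) :
    Th (consY a x) = cB (a.1 + 1) ((DD ^ a.2) (Th x)) := by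
  have : Th ∘ₗ Finsupp.lmapDomain ℚ ℚ (List.cons a) = cB (a.1 + 1) ∘ₗ (DD ^ a.2) ∘ₗ Th :=
    hom_ext_Y fun w => by
      have h : Finsupp.lmapDomain ℚ ℚ (List.cons a) (wY w) = wY (a :: w) := by
        simp [wY, Finsupp.lmapDomain_apply, Finsupp.mapDomain_single]
      simp only [LinearMap.comp_apply, h, Th_wY]
      rfl
  exact congrArg (fun f => f x) this

theorem Th_stufW (u v : List (ℕ × ℕ)) : Th (stufW u v) = BB (ThW u) (ThW v) := by
  induction u generalizing v with
  | nil => rw [stufW, Th_wY]; exact (BB_one_left _).symm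
  | cons a u ihu =>
    induction v with
    | nil => rw [stufW, Th_wY]; exact (BB_one_right _).symm
    | cons b v ihv =>
      rw [stufW]
      simp only [map_add, Th_consY]
      rw [ihu, ihu, ihv]
      rw [show ThW (a :: u) = cB (a.1 + 1) ((DD ^ a.2) (ThW u)) from rfl,
        show ThW (b :: v) = cB (b.1 + 1) ((DD ^ b.2) (ThW v)) from rfl, BB_cons,
        if_pos ⟨by omega, by omega⟩]
      simp only [BB_DDpow_left, BB_DDpow_right]
      rw [add_comm a.2, pow_add, Module.End.mul_apply, show a.1 + b.1 + 1 + 1 = a.1 + 1 + (b.1 + 1) by ring]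

theorem Th_stuf (x y : QY) : Th (stuf x y) = BB (Th x) (Th y) := by
  simp only [stuf, Finsupp.sum, map_sum, map_smul, Th_stufW]
  simp only [Th, Finsupp.linearCombination_apply, Finsupp.sum, map_sum, LinearMap.sum_apply,
    map_smul, LinearMap.smul_apply, Finset.smul_sum, mul_smul]
  rw [Finset.sum_comm]
  exact Finset.sum_congr rfl fun _ _ => Finset.sum_congr rfl fun _ _ => smul_comm _ _ _

/-! ### Surjectivity onto `ℚ⟨B⟩⁰` -/

noncomputable def TT : Submodule ℚ QB :=
  Submodule.span ℚ {x | ∃ (n : ℕ) (u : QY), x = (DD ^ n) (Th u)}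

theorem TT_DD {x : QB} (hx : x ∈ TT) : DD x ∈ TT := by
  have : TT ≤ TT.comap DD := by
    refine Submodule.span_le.2 ?_
    rintro _ ⟨n, u, rfl⟩
    refine Submodule.subset_span ⟨n + 1, u, ?_⟩
    rw [pow_succ', Module.End.mul_apply]
  exact this hx

theorem TT_cB {x : QB} (hx : x ∈ TT) (k : ℕ) : cB (k + 1) x ∈ LinearMap.range Th := by
  have : TT ≤ (LinearMap.range Th).comap (cB (k + 1)) := by
    refine Submodule.span_le.2 ?_
    rintro _ ⟨n, u, rfl⟩
    exact ⟨consY (k, n) u, Th_consY (k, n) u⟩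
  exact this hx

theorem range_le_TT : LinearMap.range Th ≤ TT := by
  rintro _ ⟨u, rfl⟩
  exact Submodule.subset_span ⟨0, u, by simp⟩

/-- Span of the words with `d` nonzero letters. -/
noncomputable def SS (d : ℕ) : Submodule ℚ QB :=
  Submodule.span ℚ {x | ∃ w : List ℕ, w.countP (· ≠ 0) = d ∧ x = wB w}

theorem SS_cB0 {d : ℕ} {x : QB} (hx : x ∈ SS d) : cB 0 x ∈ SS d := by
  have : SS d ≤ (SS d).comap (cB 0) := by
    refine Submodule.span_le.2 ?_
    rintro _ ⟨w, hw, rfl⟩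
    exact Submodule.subset_span ⟨0 :: w, by simpa using hw, cB_wB _ _⟩
  exact this hx

theorem SS_cBsucc {d : ℕ} {x : QB} (hx : x ∈ SS d) (k : ℕ) : cB (k + 1) x ∈ SS (d + 1) := by
  have : SS d ≤ (SS (d + 1)).comap (cB (k + 1)) := by
    refine Submodule.span_le.2 ?_
    rintro _ ⟨w, hw, rfl⟩
    exact Submodule.subset_span ⟨(k + 1) :: w, by simpa using hw, cB_wB _ _⟩
  exact this hx

theorem wB_mem_SS (w : List ℕ) : wB w ∈ SS (w.countP (· ≠ 0)) :=
  Submodule.subset_span ⟨w, rfl, rfl⟩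

theorem SS_DD {d : ℕ} {x : QB} (hx : x ∈ SS d) : DD x ∈ SS d := by
  have : SS d ≤ (SS d).comap DD := by
    refine Submodule.span_le.2 ?_
    rintro _ ⟨w, rfl, rfl⟩
    show DD (wB w) ∈ SS _
    clear hx
    induction w with
    | nil => rw [DD_nil]; exact SS_cB0 (wB_mem_SS [])
    | cons a w ih =>
      rw [← cB_wB, DD_cB]
      refine add_mem (SS_cB0 (by rw [cB_wB]; exact wB_mem_SS _)) ?_
      cases a with
      | zero => simpa using SS_cB0 ih
      | succ a => simpa using SS_cBsucc ih a
  exact this hx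

theorem DD_cB0pow (m : ℕ) (x : QB) :
    DD ((cB 0 ^ m) x) = (m : ℚ) • (cB 0 ^ (m + 1)) x + (cB 0 ^ m) (DD x) := by
  induction m generalizing x with
  | zero => simp
  | succ m ih =>
    rw [pow_succ' (cB 0) m, Module.End.mul_apply, DD_cB, ih, pow_succ' (cB 0) (m + 1),
      pow_succ' (cB 0) m]
    simp only [map_add, map_smul, Module.End.mul_apply]
    push_cast
    module

theorem DD_block (m k : ℕ) (x : QB) :
    DD ((cB 0 ^ m) (cB k x)) =
      ((m : ℚ) + 1) • (cB 0 ^ (m + 1)) (cB k x) + (cB 0 ^ m) (cB k (DD x)) := by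
  rw [DD_cB0pow, DD_cB, map_add, pow_succ, Module.End.mul_apply]
  module

theorem DD_block_nil (m : ℕ) :
    DD ((cB 0 ^ m) (wB [])) = ((m : ℚ) + 1) • (cB 0 ^ (m + 1)) (wB []) := by
  rw [DD_cB0pow, DD_nil, pow_succ, Module.End.mul_apply]
  module

theorem mem_of_smul {T : Submodule ℚ QB} (m : ℕ) {x : QB} (h : ((m : ℚ) + 1) • x ∈ T) :
    x ∈ T := by
  have h1 : ((m : ℚ) + 1) ≠ 0 := by positivity
  have := T.smul_mem ((m : ℚ) + 1)⁻¹ h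
  rwa [smul_smul, inv_mul_cancel₀ h1, one_smul] at this

theorem nil_mem_range : wB [] ∈ LinearMap.range Th := ⟨wY [], Th_wY []⟩

theorem pow_nil_mem (m : ℕ) : (cB 0 ^ m) (wB []) ∈ TT := by
  induction m with
  | zero => exact range_le_TT nil_mem_range
  | succ m ih =>
    apply mem_of_smul m
    rw [← DD_block_nil]
    exact TT_DD ih

theorem pow_block_mem (d : ℕ) (h : SS d ≤ TT) (m k : ℕ) (x : QB) (hx : x ∈ SS d) :
    (cB 0 ^ m) (cB (k + 1) x) ∈ TT := by
  induction m generalizing x with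
  | zero => exact range_le_TT (TT_cB (h hx) k)
  | succ m ih =>
    apply mem_of_smul m
    rw [eq_sub_of_add_eq (DD_block m (k + 1) x).symm]
    exact sub_mem (TT_DD (ih x hx)) (ih _ (SS_DD hx))

theorem word_form (w : List ℕ) : (∃ m, w = List.replicate m 0) ∨
    ∃ m k v, w = List.replicate m 0 ++ (k + 1) :: v := by
  induction w with
  | nil => exact Or.inl ⟨0, rfl⟩
  | cons a w ih =>
    cases a with
    | succ a => exact Or.inr ⟨0, a, w, rfl⟩
    | zero =>
      rcases ih with ⟨m, rfl⟩ | ⟨m, k, v, rfl⟩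
      · exact Or.inl ⟨m + 1, rfl⟩
      · exact Or.inr ⟨m + 1, k, v, rfl⟩

theorem cB0pow_wB (m : ℕ) (w : List ℕ) :
    (cB 0 ^ m) (wB w) = wB (List.replicate m 0 ++ w) := by
  induction m with
  | zero => simp
  | succ m ih => rw [pow_succ', Module.End.mul_apply, ih, cB_wB]; rfl

theorem SS_le_TT (d : ℕ) : SS d ≤ TT := by
  induction d with
  | zero =>
    refine Submodule.span_le.2 ?_
    rintro _ ⟨w, hw, rfl⟩
    rcases word_form w with ⟨m, rfl⟩ | ⟨m, k, v, rfl⟩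
    · have := pow_nil_mem m
      rw [cB0pow_wB] at this
      simpa using this
    · simp at hw
  | succ d ih =>
    refine Submodule.span_le.2 ?_
    rintro _ ⟨w, hw, rfl⟩
    rcases word_form w with ⟨m, rfl⟩ | ⟨m, k, v, rfl⟩
    · simp [List.countP_replicate] at hw
    · have hv : v.countP (· ≠ 0) = d := by
        simpa [List.countP_append, List.countP_replicate] using hw
      have := pow_block_mem d ih m k (wB v) (hv ▸ wB_mem_SS v)
      rwa [cB_wB, cB0pow_wB] at this

theorem QB0_le_range : QB0 ≤ LinearMap.range Th := by
  refine Submodule.span_le.2 ?_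
  rintro _ ⟨w, hw, rfl⟩
  cases w with
  | nil => exact nil_mem_range
  | cons a w =>
    cases a with
    | zero => simp at hw
    | succ a => rw [← cB_wB]; exact TT_cB (SS_le_TT _ (wB_mem_SS w)) a

theorem range_le_QB0 : LinearMap.range Th ≤ QB0 := by
  rintro _ ⟨x, rfl⟩
  have hc : ∀ (k : ℕ) (y : QB), cB (k + 1) y ∈ QB0 := by
    intro k y
    induction y using Finsupp.induction_linear with
    | zero => simp
    | add f g hf hg => rw [map_add]; exact add_mem hf hg
    | single w b =>
      have : (Finsupp.single w b : QB) = b • wB w := by simp [wB]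
      rw [this, map_smul, cB_wB]
      exact Submodule.smul_mem _ _ (Submodule.subset_span ⟨_, by simp, rfl⟩)
  induction x using Finsupp.induction_linear with
  | zero => simp
  | add f g hf hg => rw [map_add]; exact add_mem hf hg
  | single w b =>
    have : (Finsupp.single w b : QY) = b • wY w := by simp [wY]
    rw [this, map_smul, Th_wY]
    refine Submodule.smul_mem _ _ ?_
    cases w with
    | nil => exact Submodule.subset_span ⟨[], by simp, rfl⟩
    | cons a w => exact hc _ _

/-! ### The coefficient formula -/

/-- The word `b_{k₁}b₀^{n₁}⋯b_{k_d}b₀^{n_d}`. -/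
def encF (d : ℕ) (k n : Fin d → ℕ) : List ℕ :=
  (List.ofFn fun i : Fin d => (k i + 1) :: List.replicate (n i) 0).flatten

theorem encF_zero (k n : Fin 0 → ℕ) : encF 0 k n = [] := by simp [encF]

theorem encF_succ (d : ℕ) (k n : Fin (d + 1) → ℕ) : encF (d + 1) k n =
    (k 0 + 1) :: (List.replicate (n 0) 0 ++ encF d (fun i => k i.succ) (fun i => n i.succ)) := by
  simp [encF, List.ofFn_succ]

/-- Divided powers of `DD`. -/
noncomputable def DP (m : ℕ) : QB →ₗ[ℚ] QB := ((m.factorial : ℚ))⁻¹ • DD ^ m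

theorem DP_zero : DP 0 = LinearMap.id := by
  simp [DP]; rfl

theorem DP_succ (m : ℕ) (x : QB) : ((m : ℚ) + 1) • DP (m + 1) x = DD (DP m x) := by
  have h1 : ((m : ℚ) + 1) ≠ 0 := by positivity
  simp only [DP, LinearMap.smul_apply, pow_succ', Module.End.mul_apply, map_smul, smul_smul]
  congr 1
  rw [Nat.factorial_succ]
  push_cast
  field_simp

theorem DDpow_eq (m : ℕ) (x : QB) : (DD ^ m) x = (m.factorial : ℚ) • DP m x := by
  have h1 : (m.factorial : ℚ) ≠ 0 := by positivity
  simp only [DP, LinearMap.smul_apply, smul_smul, mul_inv_cancel₀ h1, one_smul]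

theorem choose_step (n a : ℕ) :
    ((n + a).choose a : ℚ) * ((n + a : ℕ) + 1) = (a + 1) * ((n + (a + 1)).choose (a + 1)) := by
  have := Nat.add_one_mul_choose_eq (n + a) a
  rw [← add_assoc]
  have h2 := congrArg (Nat.cast (R := ℚ)) this
  push_cast at h2 ⊢
  linarith

theorem DP_nil (m n : ℕ) :
    DP m ((cB 0 ^ n) (wB [])) = ((n + m).choose m : ℚ) • (cB 0 ^ (n + m)) (wB []) := by
  induction m with
  | zero => simp [DP_zero]
  | succ m ih =>
    have h1 : ((m : ℚ) + 1) ≠ 0 := by positivity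
    apply smul_right_injective QB h1
    show ((m : ℚ) + 1) • _ = ((m : ℚ) + 1) • _
    rw [DP_succ, ih, map_smul, DD_block_nil, smul_smul, choose_step, smul_smul]
    rfl

theorem DP_block (m n k : ℕ) (x : QB) :
    DP m ((cB 0 ^ n) (cB k x)) = ∑ p ∈ Finset.HasAntidiagonal.antidiagonal m,
      ((n + p.1).choose p.1 : ℚ) • (cB 0 ^ (n + p.1)) (cB k (DP p.2 x)) := by
  induction m with
  | zero => simp [DP_zero]
  | succ m ih =>
    have h1 : ((m : ℚ) + 1) ≠ 0 := by positivity
    apply smul_right_injective QB h1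
    show ((m : ℚ) + 1) • _ = ((m : ℚ) + 1) • _
    rw [DP_succ, ih, map_sum]
    have hL : ∀ p : ℕ × ℕ, DD (((n + p.1).choose p.1 : ℚ) •
          (cB 0 ^ (n + p.1)) (cB k (DP p.2 x))) =
        ((p.1 + 1 : ℕ) : ℚ) • (((n + (p.1 + 1)).choose (p.1 + 1) : ℚ) •
          (cB 0 ^ (n + (p.1 + 1))) (cB k (DP p.2 x))) +
        ((p.2 + 1 : ℕ) : ℚ) • (((n + p.1).choose p.1 : ℚ) •
          (cB 0 ^ (n + p.1)) (cB k (DP (p.2 + 1) x))) := by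
      intro p
      rw [map_smul, DD_block, smul_add, smul_smul, choose_step, ← DP_succ]
      simp only [map_smul, smul_smul]
      push_cast
      rw [mul_comm ((p.2 : ℚ) + 1)]
      rfl
    rw [Finset.sum_congr rfl fun p _ => hL p, Finset.sum_add_distrib, Finset.smul_sum]
    set f : ℕ × ℕ → QB := fun p =>
      ((n + p.1).choose p.1 : ℚ) • (cB 0 ^ (n + p.1)) (cB k (DP p.2 x)) with hf
    have e1 : ∑ p ∈ Finset.HasAntidiagonal.antidiagonal (m + 1), ((m : ℚ) + 1) • f p =
        ∑ p ∈ Finset.HasAntidiagonal.antidiagonal (m + 1), (p.1 : ℚ) • f p +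
        ∑ p ∈ Finset.HasAntidiagonal.antidiagonal (m + 1), (p.2 : ℚ) • f p := by
      rw [← Finset.sum_add_distrib]
      refine Finset.sum_congr rfl fun p hp => ?_
      rw [← add_smul]
      congr 1
      have := Finset.HasAntidiagonal.mem_antidiagonal.1 hp
      exact_mod_cast this.symm
    rw [e1, Finset.Nat.sum_antidiagonal_succ, Finset.Nat.sum_antidiagonal_succ']
    simp [hf]

/-- Splitting tuples into first entry and tail. -/
theorem sum_tuple_succ {N : Type*} [AddCommMonoid N] (d m : ℕ) (f : (Fin (d + 1) → ℕ) → N) :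
    ∑ c ∈ Finset.Nat.antidiagonalTuple (d + 1) m, f c =
      ∑ p ∈ Finset.HasAntidiagonal.antidiagonal m, ∑ c ∈ Finset.Nat.antidiagonalTuple d p.2,
        f (Fin.cons p.1 c) := by
  rw [Finset.sum_sigma']
  refine Finset.sum_bij' (fun c _ => ⟨(c 0, ∑ i : Fin d, c i.succ), fun i => c i.succ⟩)
    (fun s _ => Fin.cons s.1.1 s.2) ?_ ?_ ?_ ?_ ?_
  · intro c hc
    rw [Finset.Nat.mem_antidiagonalTuple, Fin.sum_univ_succ] at hc
    simp [Finset.Nat.mem_antidiagonalTuple, hc]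
  · rintro ⟨⟨a, b⟩, c⟩ hs
    simp only [Finset.mem_sigma, Finset.HasAntidiagonal.mem_antidiagonal,
      Finset.Nat.mem_antidiagonalTuple] at hs
    simp [Finset.Nat.mem_antidiagonalTuple, Fin.sum_univ_succ, hs]
  · intro c _
    exact Fin.cons_self_tail c
  · rintro ⟨⟨a, b⟩, c⟩ hs
    simp only [Finset.mem_sigma, Finset.HasAntidiagonal.mem_antidiagonal,
      Finset.Nat.mem_antidiagonalTuple] at hs
    obtain ⟨_, rfl⟩ := hs
    simp
  · intro c _
    exact congrArg f (Fin.cons_self_tail c).symm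

theorem DP_enc (d m n0 : ℕ) (k n : Fin d → ℕ) :
    DP m (wB (List.replicate n0 0 ++ encF d k n)) =
      ∑ c ∈ Finset.Nat.antidiagonalTuple (d + 1) m,
        (((n0 + c 0).choose (c 0) : ℚ) * ∏ i : Fin d, ((n i + c i.succ).choose (c i.succ) : ℚ)) •
          wB (List.replicate (n0 + c 0) 0 ++ encF d k fun i => n i + c i.succ) := by
  induction d generalizing m n0 with
  | zero =>
    rw [encF_zero, ← cB0pow_wB, DP_nil]
    simp [Finset.Nat.antidiagonalTuple_one, encF_zero, cB0pow_wB]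
  | succ d ih =>
    rw [encF_succ, ← cB0pow_wB, ← cB_wB, DP_block, sum_tuple_succ]
    refine Finset.sum_congr rfl fun p _ => ?_
    rw [ih, map_sum, map_sum, Finset.smul_sum]
    refine Finset.sum_congr rfl fun c _ => ?_
    rw [map_smul, map_smul, smul_smul, cB_wB, cB0pow_wB, encF_succ, Fin.prod_univ_succ]
    simp only [Fin.cons_zero, Fin.cons_succ]

theorem multinomial_fin_succ (d : ℕ) (f : Fin (d + 1) → ℕ) :
    Nat.multinomial Finset.univ f =
      ((∑ i : Fin d, f i.succ) + f 0).choose (f 0) *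
        Nat.multinomial Finset.univ (fun i : Fin d => f i.succ) := by
  rw [Fin.univ_succ, Nat.multinomial_cons]
  simp only [Finset.sum_map, Function.Embedding.coeFn_mk, add_comm]
  congr 1
  simp [Nat.multinomial, Finset.sum_map, Finset.prod_map]

theorem sum_matSet_succ {N : Type*} [AddCommMonoid N] (d : ℕ) (m : Fin (d + 1) → ℕ)
    (f : (Fin (d + 1) → Fin (d + 1) → ℕ) → N) :
    ∑ c ∈ matSet (d + 1) m, f c =
      ∑ c ∈ matSet d (fun i => m i.succ), ∑ t ∈ Finset.Nat.antidiagonalTuple (d + 1) (m 0),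
        f (Fin.cons t fun j => Fin.cons 0 (c j)) := by
  rw [← Finset.sum_product']
  have key : ∀ c ∈ matSet (d + 1) m,
      (Fin.cons (c 0) fun j : Fin d => Fin.cons 0 fun i : Fin d => c j.succ i.succ :
        Fin (d + 1) → Fin (d + 1) → ℕ) = c := by
    intro c hc
    have h2 := (Finset.mem_filter.1 hc).2
    funext j
    refine Fin.cases ?_ (fun j => ?_) j
    · rfl
    · funext i
      refine Fin.cases ?_ (fun i => ?_) i
      · simpa using (h2 0 j.succ (Fin.succ_pos j)).symm
      · rfl
  refine Finset.sum_bij' (fun c _ => (fun j i => c j.succ i.succ, c 0))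
    (fun s _ => Fin.cons s.2 fun j => Fin.cons 0 (s.1 j)) ?_ ?_ ?_ ?_ ?_
  · intro c hc
    have h2 := (Finset.mem_filter.1 hc).2
    have h1 := (Finset.mem_filter.1 hc).1
    simp only [Fintype.mem_piFinset, Finset.Nat.mem_antidiagonalTuple] at h1
    simp only [matSet, Finset.mem_product, Finset.mem_filter, Fintype.mem_piFinset,
      Finset.Nat.mem_antidiagonalTuple]
    refine ⟨⟨fun j => ?_, fun i j hij => h2 _ _ (Fin.succ_lt_succ_iff.2 hij)⟩, h1 0⟩
    rw [← h1 j.succ, Fin.sum_univ_succ, h2 0 j.succ (Fin.succ_pos j), zero_add]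
  · rintro ⟨c, t⟩ hs
    simp only [matSet, Finset.mem_product, Finset.mem_filter, Fintype.mem_piFinset,
      Finset.Nat.mem_antidiagonalTuple] at hs ⊢
    obtain ⟨⟨h1, h2⟩, h3⟩ := hs
    refine ⟨fun j => ?_, fun i j hij => ?_⟩
    · refine Fin.cases ?_ (fun j => ?_) j
      · simpa using h3
      · simpa [Fin.sum_univ_succ] using h1 j
    · revert hij
      refine Fin.cases ?_ (fun j => ?_) j
      · intro h; exact absurd h (Fin.not_lt_zero _)
      · refine Fin.cases ?_ (fun i => ?_) i
        · intro _; rfl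
        · intro h; exact h2 _ _ (Fin.succ_lt_succ_iff.1 h)
  · intro c hc
    exact key c hc
  · rintro ⟨c, t⟩ _
    simp
  · intro c hc
    exact congrArg f (key c hc).symm

theorem ThW_formula (d : ℕ) (k m : Fin d → ℕ) :
    ThW (List.ofFn fun i => (k i, m i)) = (∏ i, ((m i).factorial : ℚ)) •
      ∑ c ∈ matSet d m, (∏ i : Fin d, (Nat.multinomial Finset.univ (fun j => c j i) : ℚ)) •
        wB (encF d k fun i => ∑ j, c j i) := by
  induction d with
  | zero =>
    simp [matSet, ThW, encF_zero, Finset.filter_true_of_mem]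
  | succ d ih =>
    rw [List.ofFn_succ, ThW, ih, DDpow_eq, map_smul, map_smul, map_smul, smul_smul,
      Fin.prod_univ_succ, sum_matSet_succ, map_sum, map_sum]
    congr 1
    refine Finset.sum_congr rfl fun c _ => ?_
    have h := DP_enc d (m 0) 0 (fun i => k i.succ) (fun i => ∑ j, c j i)
    simp only [List.replicate_zero, List.nil_append] at h
    rw [map_smul, map_smul, h, map_sum, Finset.smul_sum]
    refine Finset.sum_congr rfl fun t _ => ?_
    rw [map_smul, cB_wB, smul_smul, encF_succ, Fin.prod_univ_succ]
    congr 1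
    · simp only [multinomial_fin_succ, Fin.cons_zero, Fin.cons_succ, zero_add,
        Finset.sum_const_zero, Nat.choose_self, Nat.cast_one, one_mul, Nat.cast_mul,
        Finset.prod_mul_distrib]
      have h0 : Nat.multinomial Finset.univ (fun _ : Fin d => 0) = 1 := by
        simp [Nat.multinomial]
      rw [h0, Nat.cast_one, one_mul, mul_comm]
    · simp only [Fin.sum_univ_succ, Fin.cons_zero, Fin.cons_succ, Finset.sum_const_zero,
        add_zero, zero_add]
      simp only [add_comm]

/-! ### Uniqueness of the factorization of words -/

def encL : List (ℕ × ℕ) → List ℕ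
  | [] => []
  | a :: w => (a.1 + 1) :: (List.replicate a.2 0 ++ encL w)

theorem encL_ofFn (d : ℕ) (k n : Fin d → ℕ) :
    encL (List.ofFn fun i => (k i, n i)) = encF d k n := by
  induction d with
  | zero => simp [encL, encF_zero]
  | succ d ih => rw [List.ofFn_succ, encL, ih, encF_succ]

theorem encL_head (w : List (ℕ × ℕ)) : (encL w).head? ≠ some 0 := by
  cases w <;> simp [encL]

theorem replicate_append_inj (m n : ℕ) (x y : List ℕ) (hx : x.head? ≠ some 0)
    (hy : y.head? ≠ some 0) (h : List.replicate m 0 ++ x = List.replicate n 0 ++ y) :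
    m = n ∧ x = y := by
  induction m generalizing n with
  | zero =>
    cases n with
    | zero => simpa using h
    | succ n => simp [List.replicate_succ] at h; simp [h] at hx
  | succ m ih =>
    cases n with
    | zero => simp [List.replicate_succ] at h; simp [← h] at hy
    | succ n =>
      simp only [List.replicate_succ, List.cons_append, List.cons.injEq, true_and] at h
      obtain ⟨h1, h2⟩ := ih n h
      exact ⟨by omega, h2⟩

theorem encL_inj : Function.Injective encL := by
  intro u
  induction u with
  | nil => intro v h; cases v <;> simp [encL] at h ⊢
  | cons a u ih =>
    intro v h
    cases v with
    | nil => simp [encL] at h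
    | cons b v =>
      simp only [encL, List.cons.injEq] at h
      obtain ⟨h1, h2⟩ := replicate_append_inj _ _ _ _ (encL_head u) (encL_head v) h.2
      rw [ih h2, show a = b from Prod.ext (by omega) h1]

/-- The exponent vector attached to a list. -/
noncomputable def exL (l : List (ℕ × ℕ)) : (Fin l.length ⊕ Fin l.length) →₀ ℕ :=
  Finsupp.equivFunOnFinite.symm (Sum.elim (fun i => (l.get i).1) fun i => (l.get i).2)

theorem M_exL {R : Type*} (M : ∀ d : ℕ, ((Fin d ⊕ Fin d) →₀ ℕ) → R) (d : ℕ)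
    (e : (Fin d ⊕ Fin d) →₀ ℕ) (l : List (ℕ × ℕ))
    (hl : l = List.ofFn fun i : Fin d => (e (Sum.inl i), e (Sum.inr i))) :
    M l.length (exL l) = M d e := by
  have hd : l.length = d := by rw [hl, List.length_ofFn]
  subst hd
  congr 1
  have h2 : ∀ i : Fin l.length, l.get i = (e (Sum.inl i), e (Sum.inr i)) := by
    intro i
    have h3 : List.ofFn l.get = List.ofFn fun i : Fin l.length => (e (Sum.inl i), e (Sum.inr i)) := by
      rw [← hl]; exact List.ofFn_get l
    exact congrFun (List.ofFn_injective h3) i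
  ext s
  rcases s with i | i <;> simp only [exL, Finsupp.equivFunOnFinite_symm_apply_apply, Sum.elim_inl,
    Sum.elim_inr, h2]

/-- The functional on `ℚ⟨B⟩` given by a bimould. -/
noncomputable def psiM {R : Type*} [Ring R] [Algebra ℚ R]
    (M : ∀ d : ℕ, ((Fin d ⊕ Fin d) →₀ ℕ) → R) : QB →ₗ[ℚ] R :=
  Finsupp.linearCombination ℚ (Function.extend encL (fun l => M l.length (exL l)) 0)

theorem psiM_spec {R : Type*} [Ring R] [Algebra ℚ R]
    (M : ∀ d : ℕ, ((Fin d ⊕ Fin d) →₀ ℕ) → R) (d : ℕ) (e : (Fin d ⊕ Fin d) →₀ ℕ) :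
    M d e = psiM M (wB (encF d (fun i => e (Sum.inl i)) fun i => e (Sum.inr i))) := by
  rw [← encL_ofFn]
  simp only [psiM, wB, Finsupp.linearCombination_single, one_smul]
  rw [encL_inj.extend_apply]
  exact (M_exL M d e _ rfl).symm

theorem sharpY_formula {R : Type*} [Ring R] [Algebra ℚ R]
    (M : ∀ d : ℕ, ((Fin d ⊕ Fin d) →₀ ℕ) → R) (ψ : QB →ₗ[ℚ] R)
    (h : ∀ (d : ℕ) (e : (Fin d ⊕ Fin d) →₀ ℕ),
      M d e = ψ (wB (encF d (fun i => e (Sum.inl i)) fun i => e (Sum.inr i))))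
    (d : ℕ) (e : (Fin d ⊕ Fin d) →₀ ℕ) :
    sharpY M d e = (∏ i : Fin d, ((e (Sum.inr i)).factorial : ℚ))⁻¹ •
        ψ (Th (wY (List.ofFn fun i : Fin d => (e (Sum.inl i), e (Sum.inr i))))) := by
  have hne : (∏ i : Fin d, ((e (Sum.inr i)).factorial : ℚ)) ≠ 0 :=
    Finset.prod_ne_zero_iff.2 fun i _ => by positivity
  rw [Th_wY, ThW_formula, map_smul, smul_smul, inv_mul_cancel₀ hne, one_smul, map_sum, sharpY]
  refine Finset.sum_congr rfl fun c _ => ?_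
  rw [map_smul, h]
  simp

/-- A bimould `M` is b-symmetril iff `M^{#_Y}` is symmetril. -/
theorem bsymmetril_iff_sharpY_symmetril {R : Type*} [Ring R] [Algebra ℚ R]
    (M : ∀ d : ℕ, ((Fin d ⊕ Fin d) →₀ ℕ) → R) :
    BSymmetril M ↔ Symmetril (sharpY M) := by
  constructor
  · rintro ⟨ψ, h1, h2, h3⟩
    refine ⟨ψ ∘ₗ Th, ?_, ?_, ?_⟩
    · rw [LinearMap.comp_apply, Th_wY]; exact h1
    · intro x y
      simp only [LinearMap.comp_apply]
      rw [Th_stuf, ← bsh_eq]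
      exact h2 _ _ (range_le_QB0 ⟨x, rfl⟩) (range_le_QB0 ⟨y, rfl⟩)
    · exact sharpY_formula M ψ h3
  · rintro ⟨φ, h1, h2, h3⟩
    have hφ : psiM M ∘ₗ Th = φ := by
      apply hom_ext_Y
      intro w
      let e : (Fin w.length ⊕ Fin w.length) →₀ ℕ := exL w
      have hw : (List.ofFn fun i : Fin w.length => (e (Sum.inl i), e (Sum.inr i))) = w := by
        simp [e, exL]
      have h4 := h3 w.length e
      rw [sharpY_formula M (psiM M) (psiM_spec M)] at h4
      have hne : (∏ i : Fin w.length, ((e (Sum.inr i)).factorial : ℚ))⁻¹ ≠ 0 :=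
        inv_ne_zero (Finset.prod_ne_zero_iff.2 fun i _ => by positivity)
      have h5 := smul_right_injective R hne h4
      rw [hw] at h5
      exact h5
    refine ⟨psiM M, ?_, ?_, psiM_spec M⟩
    · rw [← h1, ← hφ, LinearMap.comp_apply, Th_wY]; rfl
    · intro x y hx hy
      obtain ⟨x, rfl⟩ := QB0_le_range hx
      obtain ⟨y, rfl⟩ := QB0_le_range hy
      have := h2 x y
      rw [← hφ] at this
      simp only [LinearMap.comp_apply] at this
      rw [bsh_eq, ← Th_stuf, this]
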